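/- With the insertion construction below, the map h_ε : L_p(α) → Λ(Φ_p), defined as the inverse of y ↦ x(y) (it eliminates all inserted digits at positions n(k), k ∈ ℕ), is Hölder continuous with exponent 1/(1+ε). -/

import Mathlib

open Set MeasureTheory Filter Topology

open scoped ENNReal NNReal Classical

namespace ParabolicIFSPaper

noncomputable section

/-- Composition `φ_{ω₁} ∘ ⋯ ∘ φ_{ω_n}` for a (0-indexed) sequence of digits `ω`. -/
def comp (φ : ℕ → ℝ → ℝ) (ω : ℕ → ℕ) : ℕ → ℝ → ℝ
  | 0 => id
  | n + 1 => comp φ ω n ∘ φ (ω n)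

/-- Composition `φ_{a₁} ∘ ⋯ ∘ φ_{a_n}` along a finite word given as a list. -/
def wcomp (φ : ℕ → ℝ → ℝ) : List ℕ → ℝ → ℝ
  | [] => id
  | a :: l => φ a ∘ wcomp φ l

/-- A parabolic Iterated Function System on `[0,1]`:  an index set `I ⊆ ℕ` with at least two
elements, `C¹` maps `φ i : [0,1] → [0,1]`, the open set condition, the non-uniform contraction
condition (A1) with finitely many parabolic pairs, and the bounded distortion condition (A2). -/
structure PIFS where
  I : Set ℕ
  I_nontrivial : I.Nontrivial
  φ : ℕ → ℝ → ℝ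
  smooth : ∀ i ∈ I, ContDiff ℝ 1 (φ i)
  maps_to : ∀ i ∈ I, MapsTo (φ i) (Icc (0:ℝ) 1) (Icc (0:ℝ) 1)
  osc : ∀ i ∈ I, ∀ j ∈ I, i ≠ j → φ i '' Ioo (0:ℝ) 1 ∩ φ j '' Ioo (0:ℝ) 1 = ∅
  Par : Set ℕ
  Par_sub : Par ⊆ I
  Par_finite : Par.Finite
  fixpt : ℕ → ℝ
  fixpt_mem : ∀ i ∈ Par, fixpt i ∈ Icc (0:ℝ) 1
  fixpt_fixed : ∀ i ∈ Par, φ i (fixpt i) = fixpt i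
  fixpt_unique : ∀ i ∈ Par, ∀ x ∈ Icc (0:ℝ) 1, φ i x = x → x = fixpt i
  deriv_one : ∀ i ∈ Par, |deriv (φ i) (fixpt i)| = 1
  contracting : ∀ i ∈ I, ∀ x ∈ Icc (0:ℝ) 1, (i ∉ Par ∨ x ≠ fixpt i) → |deriv (φ i) x| < 1
  distC : ℝ
  distC_ge_one : 1 ≤ distC
  distortion : ∀ ω : ℕ → ℕ, (∀ k, ω k ∈ I) → ∀ n, 2 ≤ n →
    (ω (n - 1) ∉ Par ∨ ω (n - 2) ≠ ω (n - 1)) →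
    ∀ x ∈ Icc (0:ℝ) 1, ∀ y ∈ Icc (0:ℝ) 1,
      |deriv (comp φ ω n) x| ≤ distC * |deriv (comp φ ω n) y|

/-- The set of admissible digit sequences `I^ℕ`. -/
def PIFS.Seqs (Φ : PIFS) : Set (ℕ → ℕ) := {ω | ∀ k, ω k ∈ Φ.I}

/-- The set of admissible words of length `n`, i.e. `I^n`. -/
def Words (Φ : PIFS) (n : ℕ) : Set (List ℕ) := {l | l.length = n ∧ ∀ a ∈ l, a ∈ Φ.I}

/-- The fundamental interval `J(ω) = φ_ω([0,1])` of a finite word. -/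
def Jset (Φ : PIFS) (l : List ℕ) : Set ℝ := wcomp Φ.φ l '' Icc (0:ℝ) 1

/-- `Pi` is an address map for `Φ` if `Pi ω` lies in every fundamental interval
`φ_{ω₁⋯ω_n}([0,1])`; since these intersections are singletons for a parabolic IFS, this
characterizes the address map. -/
def IsAddressMap (Φ : PIFS) (Pi : (ℕ → ℕ) → ℝ) : Prop :=
  ∀ ω ∈ Φ.Seqs, ∀ n : ℕ, Pi ω ∈ comp Φ.φ ω n '' Icc (0:ℝ) 1

/-- The limit set `Λ(Φ) = Π(I^ℕ)`. -/
def limitSet (Φ : PIFS) (Pi : (ℕ → ℕ) → ℝ) : Set ℝ := Pi '' Φ.Seqs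

/-- The set `Λ_*(Φ)` of points having exactly one address. -/
def uniqueCoded (Φ : PIFS) (Pi : (ℕ → ℕ) → ℝ) : Set ℝ :=
  {x | ∃! ω : ℕ → ℕ, ω ∈ Φ.Seqs ∧ Pi ω = x}

/-- `max{a₁(x),…,a_n(x)} ⋅ (log log n) / n` for the digit sequence `ω`. -/
def ratio (ω : ℕ → ℕ) (n : ℕ) : ℝ :=
  ((((Finset.range n).sup ω : ℕ) : ℝ)) * Real.log (Real.log n) / n

/-- The level set `L(α)` of points whose largest-digit growth rate is `α ∈ [0,∞]`. -/
def levelSet (Φ : PIFS) (Pi : (ℕ → ℕ) → ℝ) (α : EReal) : Set ℝ :=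
  {x ∈ uniqueCoded Φ Pi |
    ∀ ω ∈ Φ.Seqs, Pi ω = x → Tendsto (fun n => (ratio ω n : EReal)) atTop (𝓝 α)}

/-- `Φ` is `d`-decaying: `min_x |φ_i'(x)| ≥ c / i^d`. -/
def Decaying (Φ : PIFS) (d : ℝ) : Prop :=
  ∃ c : ℝ, 0 < c ∧ ∀ i ∈ Φ.I, ∀ x ∈ Icc (0:ℝ) 1, c / (i : ℝ) ^ d ≤ |deriv (Φ.φ i) x|

/-- The shift map on sequence space. -/
def shift : (ℕ → ℕ) → (ℕ → ℕ) := fun ω n => ω (n + 1)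

/-- The Lyapunov exponent `χ(ν) = -∫ log |φ'_{ω₁}(Π ω)| dν(ω)` (in `[0,∞]`). -/
def lyap (Φ : PIFS) (Pi : (ℕ → ℕ) → ℝ) (ν : Measure (ℕ → ℕ)) : ℝ≥0∞ :=
  ∫⁻ ω, ENNReal.ofReal (- Real.log |deriv (Φ.φ (ω 0)) (Pi ω)|) ∂ν

/-- The class `𝓜(Φ)` of shift-invariant ergodic probability measures carried by `I^ℕ`
with finite Lyapunov exponent. -/
def MeasClass (Φ : PIFS) (Pi : (ℕ → ℕ) → ℝ) : Set (Measure (ℕ → ℕ)) :=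
  {ν | IsProbabilityMeasure ν ∧ ν Φ.Seqs = 1 ∧ Ergodic shift ν ∧ lyap Φ Pi ν < ⊤}

/-- `dim(μ) = inf {dim_H A : A ⊆ [0,1], μ(A) = 1}`. -/
def mdim (μ : Measure ℝ) : ℝ≥0∞ :=
  ⨅ (A : Set ℝ) (_ : A ⊆ Icc (0:ℝ) 1) (_ : μ A = 1), dimH A

/-- Condition (B1) (saturation). -/
def SatB1 (Φ : PIFS) (Pi : (ℕ → ℕ) → ℝ) : Prop :=
  dimH (limitSet Φ Pi) = ⨆ ν ∈ MeasClass Φ Pi, mdim (Measure.map Pi ν)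

/-- Condition (B2) (mild distortion): `D₁(Φ) < ∞` and `D_n(Φ) = o(n)`. -/
def MildB2 (Φ : PIFS) : Prop :=
  (∃ C : ℝ, ∀ i ∈ Φ.I, ∀ x ∈ Icc (0:ℝ) 1, ∀ y ∈ Icc (0:ℝ) 1,
    |deriv (Φ.φ i) x| ≤ C * |deriv (Φ.φ i) y|) ∧
  ∀ ε : ℝ, 0 < ε → ∃ N : ℕ, ∀ n, N ≤ n → ∀ l ∈ Words Φ n,
    ∀ x ∈ Icc (0:ℝ) 1, ∀ y ∈ Icc (0:ℝ) 1,
      |deriv (wcomp Φ.φ l) x| ≤ Real.exp (ε * n) * |deriv (wcomp Φ.φ l) y|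

/-- Composition along a sequence of finite words:
`φ_{σ₀} ∘ φ_{σ₁} ∘ ⋯ ∘ φ_{σ_{n-1}}`. -/
def seqComp (φ : ℕ → ℝ → ℝ) (σ : ℕ → List ℕ) : ℕ → ℝ → ℝ
  | 0 => id
  | n + 1 => seqComp φ σ n ∘ wcomp φ (σ n)

/-- The limit set of the finite IFS `{φ_w}_{w ∈ W}` indexed by words. -/
def finLimitSet (φ : ℕ → ℝ → ℝ) (W : Set (List ℕ)) : Set ℝ :=
  {x | ∃ σ : ℕ → List ℕ, (∀ k, σ k ∈ W) ∧ ∀ n, x ∈ seqComp φ σ n '' Icc (0:ℝ) 1}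

/-- `τ(x) = x / log log x`. -/
def tau (x : ℝ) : ℝ := x / Real.log (Real.log x)

/-- Number of insertion positions among `1,…,j`. -/
def cnt (nseq : ℕ → ℕ) (j : ℕ) : ℕ :=
  ((Finset.range (j + 1)).filter fun k => 1 ≤ k ∧ nseq k ≤ j).card

/-- Insertion of the digits `⌊α τ(n(k))⌋` at the positions `n(k)`, `k ≥ 1`, into the
(0-indexed) digit sequence `b`; index `m` corresponds to the (1-indexed) position `m + 1`. -/
def insertSeq (nseq : ℕ → ℕ) (α : ℝ) (b : ℕ → ℕ) : ℕ → ℕ := fun m =>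
  if ∃ k, 1 ≤ k ∧ nseq k = m + 1 then ⌊α * tau (m + 1)⌋₊
  else b (m - cnt nseq (m + 1))

/-- The digit sequence obtained by concatenating the words `σ 0, σ 1, …`, each of length `p`. -/
def flattenSeq (p : ℕ) (σ : ℕ → List ℕ) : ℕ → ℕ := fun m => (σ (m / p)).getD (m % p) 0

/-- The set `L_p(α)` of points obtained from points of `Λ(Φ_p)` by inserting the digits
`⌊α τ(n(k))⌋` at the positions `n(k)`. -/
def LpSet (Φ : PIFS) (Pi : (ℕ → ℕ) → ℝ) (W : Set (List ℕ)) (p : ℕ)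
    (nseq : ℕ → ℕ) (α : ℝ) : Set ℝ :=
  {x | ∃ σ : ℕ → List ℕ, (∀ k, σ k ∈ W) ∧ x = Pi (insertSeq nseq α (flattenSeq p σ))}

/-- The set `A_k` of admissible words `a₁ ⋯ a_{n(k+1)}` (0-indexed: `a 0 = a₁`):
each block between consecutive insertion positions is a concatenation of words of `W`,
and the digit at each insertion position `n(j+1)` is `⌊α τ(n(j+1))⌋`. -/
def Aset (Φ : PIFS) (W : Set (List ℕ)) (p : ℕ) (nseq mseq : ℕ → ℕ) (α : ℝ) (k : ℕ) :
    Set (ℕ → ℕ) :=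
  {a | (∀ i < nseq (k + 1), a i ∈ Φ.I) ∧
    ∀ j ≤ k,
      (∀ i < mseq j, ∃ w ∈ W, ∀ r < p, a (nseq j + i * p + r) = w.getD r 0) ∧
      a (nseq (j + 1) - 1) = ⌊α * tau (nseq (j + 1))⌋₊}

/-- `B_k = {n(k) + m p : m = 0,…,m(k)}`. -/
def Bset (nseq mseq : ℕ → ℕ) (p k : ℕ) : Set ℕ :=
  {n | ∃ m ≤ mseq k, n = nseq k + m * p}

/-- The composition `φ_{ā₁⋯ā_n}` along the word obtained from `a₁ ⋯ a_n` by eliminating the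
digits at the insertion positions `n(1), n(2), …` (0-indexed: index `n` ↔ position `n + 1`). -/
def elimComp (φ : ℕ → ℝ → ℝ) (nseq : ℕ → ℕ) (a : ℕ → ℕ) : ℕ → ℝ → ℝ
  | 0 => id
  | n + 1 =>
    if ∃ k, 1 ≤ k ∧ nseq k = n + 1 then elimComp φ nseq a n
    else elimComp φ nseq a n ∘ φ (a n)

/-- The minimal distance `K` between distinct fundamental intervals `J(w)`, `w ∈ W`. -/
def Kdist (Φ : PIFS) (W : Set (List ℕ)) : ℝ :=
  sInf {r | ∃ w ∈ W, ∃ w' ∈ W, w ≠ w' ∧ ∃ u ∈ Jset Φ w, ∃ v ∈ Jset Φ w', r = |u - v|}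

/-- The data of the insertion construction of Section 3 of the paper: a `d`-decaying
parabolic IFS `Φ` with address map `Pi` satisfying (B1) and (B2), `ε > 0`, an integer `p ≥ 2`
with `(k+p+1)^d + 2p + 1 < (k+p+2)^d`, a finite set `W ⊆ I^p` of words with pairwise disjoint
fundamental intervals, non-parabolic last letters, uniform contraction rate `e^{-γp}` and
limit set of dimension `> dim_H Λ(Φ) - ε`, the insertion positions `n(k)` (with the block
lengths `m(k)`), and `α ∈ (0,∞)`, the inserted digits `⌊α τ(n(k))⌋` belonging to `I`. -/
structure InsSetup (Φ : PIFS) (Pi : (ℕ → ℕ) → ℝ) where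
  d : ℝ
  hd : 1 < d
  hdec : Decaying Φ d
  hPi : IsAddressMap Φ Pi
  hPiMeas : Measurable Pi
  hB1 : SatB1 Φ Pi
  hB2 : MildB2 Φ
  ε : ℝ
  hε : 0 < ε
  p : ℕ
  hp2 : 2 ≤ p
  hpd : ∀ k : ℕ, ((k : ℝ) + p + 1) ^ d + 2 * p + 1 < ((k : ℝ) + p + 2) ^ d
  W : Finset (List ℕ)
  hWne : W.Nonempty
  hWsub : (↑W : Set (List ℕ)) ⊆ Words Φ p
  hWdisj : ∀ w ∈ W, ∀ w' ∈ W, w ≠ w' → Jset Φ w ∩ Jset Φ w' = ∅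
  hWlast : ∀ w ∈ W, ∀ h : w ≠ [], w.getLast h ∉ Φ.Par
  γ : ℝ
  hγ : 0 < γ
  hWcontr : ∀ w ∈ W, ∀ x ∈ Icc (0:ℝ) 1, |deriv (wcomp Φ.φ w) x| < Real.exp (-(γ * p))
  hWdim : dimH (limitSet Φ Pi) - ENNReal.ofReal ε < dimH (finLimitSet Φ.φ (↑W : Set (List ℕ)))
  α : ℝ
  hα : 0 < α
  nseq : ℕ → ℕ
  mseq : ℕ → ℕ
  hn0 : nseq 0 = 0
  hm2 : ∀ k, 2 ≤ mseq k
  hmlow : ∀ k : ℕ, (nseq k : ℝ) + ((mseq k : ℝ) - 1) * p ≤ ((k : ℝ) + p + 1) ^ d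
  hmhigh : ∀ k : ℕ, ((k : ℝ) + p + 1) ^ d < (nseq k : ℝ) + (mseq k : ℝ) * p
  hnrec : ∀ k, nseq (k + 1) = nseq k + mseq k * p + 1
  hins : ∀ k, 1 ≤ k → ⌊α * tau (nseq k)⌋₊ ∈ Φ.I

section Compositions

variable {φ : ℕ → ℝ → ℝ} {ω ω' : ℕ → ℕ}

lemma comp_add (φ : ℕ → ℝ → ℝ) (ω : ℕ → ℕ) (m n : ℕ) :
    comp φ ω (m + n) = comp φ ω m ∘ comp φ (fun r => ω (m + r)) n := by
  induction n with
  | zero => rfl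
  | succ n ih =>
    change comp φ ω (m + n) ∘ φ (ω (m + n)) = _
    rw [ih]
    rfl

lemma comp_congr {n : ℕ} (h : ∀ r < n, ω r = ω' r) : comp φ ω n = comp φ ω' n := by
  induction n with
  | zero => rfl
  | succ n ih =>
    change comp φ ω n ∘ φ (ω n) = comp φ ω' n ∘ φ (ω' n)
    rw [ih fun r hr => h r (by omega), h n (by omega)]

lemma comp_eq_wcomp (l : List ℕ) {ω : ℕ → ℕ} (h : ∀ r < l.length, ω r = l.getD r 0) :
    comp φ ω l.length = wcomp φ l := by
  induction l generalizing ω with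
  | nil => rfl
  | cons a l ih =>
    rw [List.length_cons, add_comm, comp_add]
    have h0 : ω 0 = a := by simpa using h 0 (by simp)
    rw [ih (ω := fun r => ω (1 + r))]
    · simp [comp, wcomp, h0]
    · intro r hr
      have := h (1 + r) (by simp; omega)
      rwa [add_comm 1 r, List.getD_cons_succ, add_comm r 1] at this

end Compositions

section Regularity

variable {Φ : PIFS} {ω : ℕ → ℕ}

lemma differentiable_comp (hω : ω ∈ Φ.Seqs) (n : ℕ) : Differentiable ℝ (comp Φ.φ ω n) := by
  induction n with
  | zero => exact differentiable_id
  | succ n ih => exact ih.comp ((Φ.smooth _ (hω n)).differentiable (by norm_num))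

lemma mapsTo_comp (hω : ω ∈ Φ.Seqs) (n : ℕ) :
    MapsTo (comp Φ.φ ω n) (Icc (0:ℝ) 1) (Icc (0:ℝ) 1) := by
  induction n with
  | zero => exact mapsTo_id _
  | succ n ih => exact ih.comp (Φ.maps_to _ (hω n))

lemma continuous_wcomp {l : List ℕ} (hl : ∀ a ∈ l, a ∈ Φ.I) : Continuous (wcomp Φ.φ l) := by
  induction l with
  | nil => exact continuous_id
  | cons a l ih =>
    exact (Φ.smooth a (hl a (by simp))).continuous.comp
      (ih fun b hb => hl b (List.mem_cons_of_mem _ hb))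

lemma abs_deriv_comp_add (hω : ω ∈ Φ.Seqs) (m n : ℕ) (x : ℝ) :
    |deriv (comp Φ.φ ω (m + n)) x| =
      |deriv (comp Φ.φ ω m) (comp Φ.φ (fun r => ω (m + r)) n x)| *
        |deriv (comp Φ.φ (fun r => ω (m + r)) n) x| := by
  have hs : (fun r => ω (m + r)) ∈ Φ.Seqs := fun k => hω _
  rw [comp_add, deriv_comp _ (differentiable_comp hω m _) (differentiable_comp hs n _), abs_mul]

lemma abs_deriv_comp_succ (hω : ω ∈ Φ.Seqs) (n : ℕ) (x : ℝ) :
    |deriv (comp Φ.φ ω (n + 1)) x| =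
      |deriv (comp Φ.φ ω n) (Φ.φ (ω n) x)| * |deriv (Φ.φ (ω n)) x| := by
  change |deriv (comp Φ.φ ω n ∘ Φ.φ (ω n)) x| = _
  rw [deriv_comp _ (differentiable_comp hω n _)
    ((Φ.smooth _ (hω n)).differentiable (by norm_num) _), abs_mul]

lemma exists_abs_sub_eq_abs_deriv_mul {f : ℝ → ℝ} (hf : Differentiable ℝ f) {u v : ℝ}
    (hu : u ∈ Icc (0:ℝ) 1) (hv : v ∈ Icc (0:ℝ) 1) :
    ∃ ξ ∈ Icc (0:ℝ) 1, |f u - f v| = |deriv f ξ| * |u - v| := by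
  wlog h : u ≤ v generalizing u v
  · obtain ⟨ξ, hξ, h'⟩ := this hv hu (le_of_not_ge h)
    exact ⟨ξ, hξ, by rw [abs_sub_comm, h', abs_sub_comm v u]⟩
  rcases h.eq_or_lt with rfl | h
  · exact ⟨u, hu, by simp⟩
  obtain ⟨ξ, hξ, he⟩ := exists_deriv_eq_slope f h hf.continuous.continuousOn hf.differentiableOn
  refine ⟨ξ, ⟨hu.1.trans hξ.1.le, hξ.2.le.trans hv.2⟩, ?_⟩
  rw [← abs_mul, he, abs_sub_comm, abs_mul, abs_sub_comm u v, ← abs_mul,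
    div_mul_cancel₀ _ (sub_pos.2 h).ne']

end Regularity

lemma exists_rpow_mul_log_le {d A B : ℝ} (hd : 1 < d) (hB : 0 < B) :
    ∃ C : ℝ, ∀ n : ℕ, 1 ≤ n →
      (n : ℝ) ^ (1 / d) * (A + d * Real.log n) ≤ B * n + C := by
  have hd0 : 0 < d := by linarith
  have hs : 0 < 1 - 1 / d := by
    have : 1 / d < 1 := (div_lt_one hd0).2 hd
    linarith
  have h1 : (fun x : ℝ => A + d * Real.log x) =o[atTop] fun x => x ^ (1 - 1 / d) := by
    refine Asymptotics.IsLittleO.add ?_ ((isLittleO_log_rpow_atTop hs).const_mul_left d)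
    exact Asymptotics.isLittleO_const_left.2
      (Or.inr (tendsto_norm_atTop_atTop.comp (tendsto_rpow_atTop hs)))
  have h2 := (h1.def hB)
  have h3 : ∀ᶠ n : ℕ in atTop, (n : ℝ) ^ (1 / d) * (A + d * Real.log n) ≤ B * n := by
    filter_upwards [tendsto_natCast_atTop_atTop.eventually h2, eventually_ge_atTop 1]
      with n hn hn1
    have hn0 : (0:ℝ) < n := by exact_mod_cast hn1
    rw [Real.norm_eq_abs, Real.norm_eq_abs, abs_of_nonneg (Real.rpow_nonneg hn0.le _)] at hn
    calc (n : ℝ) ^ (1 / d) * (A + d * Real.log n)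
        ≤ (n : ℝ) ^ (1 / d) * (B * (n : ℝ) ^ (1 - 1 / d)) := by
          gcongr
          exact (le_abs_self _).trans hn
      _ = B * ((n : ℝ) ^ (1 / d) * (n : ℝ) ^ (1 - 1 / d)) := by ring
      _ = B * n := by rw [← Real.rpow_add hn0]; simp
  obtain ⟨N, hN⟩ := eventually_atTop.1 h3
  obtain ⟨C, hC⟩ := ((Set.finite_lt_nat N).image fun n : ℕ =>
    (n : ℝ) ^ (1 / d) * (A + d * Real.log n) - B * n).bddAbove
  refine ⟨max C 0, fun n _ => ?_⟩
  rcases lt_or_ge n N with h | h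
  · have := hC (mem_image_of_mem _ (show n ∈ {i | i < N} from h))
    have := le_max_left C 0
    linarith
  · have := hN n h
    have := le_max_right C 0
    linarith

lemma exists_holder_of_finite {L : Set ℝ} (hL : L.Finite) (h : ℝ → ℝ) (s : ℝ) :
    ∃ C : ℝ, 0 ≤ C ∧ ∀ x ∈ L, ∀ y ∈ L, |h x - h y| ≤ C * |x - y| ^ s := by
  obtain ⟨C, hC⟩ := ((hL.prod hL).image fun z : ℝ × ℝ =>
    |h z.1 - h z.2| / |z.1 - z.2| ^ s).bddAbove
  refine ⟨max C 0, le_max_right _ _, fun x hx y hy => ?_⟩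
  rcases eq_or_ne x y with rfl | hxy
  · simp only [sub_self, abs_zero]
    exact mul_nonneg (le_max_right _ _) (Real.rpow_nonneg le_rfl _)
  · have hpos : 0 < |x - y| ^ s := Real.rpow_pos_of_pos (abs_pos.2 (sub_ne_zero.2 hxy)) _
    rw [← div_le_iff₀ hpos]
    exact (hC (mem_image_of_mem _ (show (x, y) ∈ L ×ˢ L from ⟨hx, hy⟩))).trans (le_max_left _ _)

namespace InsSetup

variable {Φ : PIFS} {Pi : (ℕ → ℕ) → ℝ} (S : InsSetup Φ Pi)

/-- The number of words of `W` preceding the `k`-th insertion position. -/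
def wordCount (k : ℕ) : ℕ := ∑ j ∈ Finset.range k, S.mseq j

/-- The digit sequence obtained from the concatenation of the words `σ j` by insertion. -/
def digits (σ : ℕ → List ℕ) : ℕ → ℕ := insertSeq S.nseq S.α (flattenSeq S.p σ)

lemma wordCount_succ (k : ℕ) : S.wordCount (k + 1) = S.wordCount k + S.mseq k :=
  Finset.sum_range_succ _ _

lemma wordCount_mono : Monotone S.wordCount :=
  monotone_nat_of_le_succ fun k => by rw [wordCount_succ]; omega

lemma nseq_eq (k : ℕ) : S.nseq k = S.wordCount k * S.p + k := by
  induction k with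
  | zero => simp [S.hn0, wordCount]
  | succ k ih => rw [S.hnrec, ih, wordCount_succ]; ring

lemma nseq_strictMono : StrictMono S.nseq :=
  strictMono_nat_of_lt_succ fun k => by rw [S.hnrec]; omega

lemma exists_wordCount_add (q : ℕ) : ∃ k i, q = S.wordCount k + i ∧ i < S.mseq k := by
  induction q with
  | zero => exact ⟨0, 0, by simp [wordCount], by have := S.hm2 0; omega⟩
  | succ q ih =>
    obtain ⟨k, i, rfl, hi⟩ := ih
    rcases Nat.lt_or_ge (i + 1) (S.mseq k) with h | h
    · exact ⟨k, i + 1, by omega, h⟩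
    · exact ⟨k + 1, 0, by rw [wordCount_succ]; omega, by have := S.hm2 (k + 1); omega⟩

lemma exists_nseq_add (r : ℕ) : ∃ k s, r = S.nseq k + s ∧ s ≤ S.mseq k * S.p := by
  induction r with
  | zero => exact ⟨0, 0, by simp [S.hn0], by omega⟩
  | succ r ih =>
    obtain ⟨k, s, rfl, hs⟩ := ih
    rcases hs.lt_or_eq with h | rfl
    · exact ⟨k, s + 1, by omega, h⟩
    · exact ⟨k + 1, 0, by rw [S.hnrec], by omega⟩

lemma cnt_eq {k j : ℕ} (h1 : S.nseq k ≤ j) (h2 : j < S.nseq (k + 1)) : cnt S.nseq j = k := by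
  have hm := S.nseq_strictMono
  have : (Finset.range (j + 1)).filter (fun t => 1 ≤ t ∧ S.nseq t ≤ j) = Finset.Icc 1 k := by
    ext t
    simp only [Finset.mem_filter, Finset.mem_range, Finset.mem_Icc]
    constructor
    · rintro ⟨-, h, h'⟩
      exact ⟨h, Nat.lt_succ_iff.1 (hm.lt_iff_lt.1 (h'.trans_lt h2))⟩
    · rintro ⟨h, h'⟩
      have h3 := hm.monotone h'
      have h4 := hm.le_apply (x := t)
      exact ⟨by omega, h, by omega⟩
  unfold cnt
  rw [this, Nat.card_Icc, Nat.add_sub_cancel]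

variable {S} {σ σ' : ℕ → List ℕ}

lemma digits_block (σ : ℕ → List ℕ) {k s : ℕ} (hs : s < S.mseq k * S.p) :
    S.digits σ (S.nseq k + s) = flattenSeq S.p σ (S.wordCount k * S.p + s) := by
  have hm := S.nseq_strictMono
  have hrec := S.hnrec k
  unfold digits insertSeq
  rw [if_neg, S.cnt_eq (k := k) (by omega) (by omega), S.nseq_eq]
  · congr 1
    omega
  · rintro ⟨t, -, ht⟩
    have h1 : k < t := hm.lt_iff_lt.1 (by omega)
    have h2 : t < k + 1 := hm.lt_iff_lt.1 (by omega)
    omega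

lemma digits_insert (σ : ℕ → List ℕ) (k : ℕ) :
    S.digits σ (S.nseq k + S.mseq k * S.p) = ⌊S.α * tau (S.nseq (k + 1))⌋₊ := by
  unfold digits insertSeq
  rw [if_pos ⟨k + 1, by omega, S.hnrec k⟩, S.hnrec k]
  push_cast
  rfl

lemma length_word (hσ : ∀ k, σ k ∈ S.W) (q : ℕ) : (σ q).length = S.p := (S.hWsub (hσ q)).1

lemma flattenSeq_word (σ : ℕ → List ℕ) (q : ℕ) {r : ℕ} (hr : r < S.p) :
    flattenSeq S.p σ (q * S.p + r) = (σ q).getD r 0 := by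
  unfold flattenSeq
  have hp : 0 < S.p := by omega
  rw [add_comm, Nat.add_mul_div_right _ _ hp, Nat.add_mul_mod_self_right, Nat.mod_eq_of_lt hr,
    Nat.div_eq_of_lt hr, zero_add]

lemma flattenSeq_mem (hσ : ∀ k, σ k ∈ S.W) : flattenSeq S.p σ ∈ Φ.Seqs := by
  intro m
  have hp := S.hp2
  have hlt : m % S.p < (σ (m / S.p)).length := by
    rw [length_word hσ]
    exact Nat.mod_lt _ (by omega)
  unfold flattenSeq
  rw [List.getD_eq_getElem _ _ hlt]
  exact (S.hWsub (hσ _)).2 _ (List.getElem_mem _)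

lemma digits_mem (hσ : ∀ k, σ k ∈ S.W) : S.digits σ ∈ Φ.Seqs := by
  intro m
  obtain ⟨k, s, rfl, hs⟩ := S.exists_nseq_add m
  rcases hs.lt_or_eq with h | rfl
  · rw [digits_block σ h]
    exact flattenSeq_mem hσ _
  · rw [digits_insert]
    exact S.hins _ (by omega)

lemma comp_flattenSeq_word (hσ : ∀ k, σ k ∈ S.W) (q : ℕ) :
    comp Φ.φ (fun r => flattenSeq S.p σ (q * S.p + r)) S.p = wcomp Φ.φ (σ q) := by
  have hl := length_word hσ q
  rw [← comp_eq_wcomp (φ := Φ.φ) (σ q) (ω := fun r => flattenSeq S.p σ (q * S.p + r)), hl]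
  intro r hr
  exact flattenSeq_word σ q (by omega)

lemma seqComp_eq_comp (hσ : ∀ k, σ k ∈ S.W) (q : ℕ) :
    seqComp Φ.φ σ q = comp Φ.φ (flattenSeq S.p σ) (q * S.p) := by
  induction q with
  | zero => simp [seqComp, comp]
  | succ q ih =>
    rw [Nat.succ_mul, comp_add, comp_flattenSeq_word hσ, ← ih]
    rfl

lemma flattenSeq_congr {q : ℕ} (h : ∀ j < q, σ j = σ' j) {m : ℕ} (hm : m < q * S.p) :
    flattenSeq S.p σ m = flattenSeq S.p σ' m := by
  unfold flattenSeq
  rw [h _ (Nat.div_lt_of_lt_mul (by rwa [mul_comm]))]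

lemma digits_congr {k i : ℕ} (h : ∀ j < S.wordCount k + i, σ j = σ' j) {r : ℕ}
    (hi : i ≤ S.mseq k) (hr : r < S.nseq k + i * S.p) : S.digits σ r = S.digits σ' r := by
  obtain ⟨t, s, rfl, hs⟩ := S.exists_nseq_add r
  rcases hs.lt_or_eq with hlt | rfl
  · rw [digits_block σ hlt, digits_block σ' hlt]
    refine flattenSeq_congr h ?_
    have hiM : i * S.p ≤ S.mseq k * S.p := Nat.mul_le_mul_right _ hi
    have ht : t < k + 1 := S.nseq_strictMono.lt_iff_lt.1 (by have := S.hnrec k; omega)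
    rcases (Nat.lt_succ_iff.1 ht).lt_or_eq with ht | rfl
    · have h1 := Nat.mul_le_mul_right S.p (S.wordCount_mono (show t + 1 ≤ k from ht))
      rw [wordCount_succ, add_mul] at h1
      rw [add_mul]
      omega
    · rw [add_mul]
      omega
  · rw [digits_insert, digits_insert]

/-- Bounded distortion along consecutive words of `W`. -/
lemma distortion_words (hσ : ∀ k, σ k ∈ S.W) (q i : ℕ) {x y : ℝ}
    (hx : x ∈ Icc (0:ℝ) 1) (hy : y ∈ Icc (0:ℝ) 1) :
    |deriv (comp Φ.φ (fun r => flattenSeq S.p σ (q * S.p + r)) (i * S.p)) x| ≤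
      Φ.distC * |deriv (comp Φ.φ (fun r => flattenSeq S.p σ (q * S.p + r)) (i * S.p)) y| := by
  have hp := S.hp2
  rcases i with _ | i
  · simpa [comp] using Φ.distC_ge_one
  · have hle : S.p ≤ (i + 1) * S.p := Nat.le_mul_of_pos_left _ (by omega)
    refine Φ.distortion _ (fun k => flattenSeq_mem hσ _) _ (by omega) (Or.inl ?_) x hx y hy
    have he : q * S.p + ((i + 1) * S.p - 1) = (q + i) * S.p + (S.p - 1) := by
      rw [add_mul, add_mul]
      omega
    have hlen := length_word hσ (q + i)
    have hne : σ (q + i) ≠ [] := by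
      intro h0
      rw [h0] at hlen
      simp at hlen
      omega
    change flattenSeq S.p σ (q * S.p + ((i + 1) * S.p - 1)) ∉ Φ.Par
    rw [he, flattenSeq_word σ _ (by omega), List.getD_eq_getElem _ _ (by omega)]
    have := S.hWlast _ (hσ (q + i)) hne
    rw [List.getLast_eq_getElem] at this
    simpa [hlen] using this

lemma abs_deriv_comp_flattenSeq_le (hσ : ∀ k, σ k ∈ S.W) (q : ℕ) {x : ℝ}
    (hx : x ∈ Icc (0:ℝ) 1) :
    |deriv (comp Φ.φ (flattenSeq S.p σ) (q * S.p)) x| ≤ Real.exp (-(S.γ * (q * S.p : ℕ))) := by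
  induction q generalizing x with
  | zero => simp [comp]
  | succ q ih =>
    have hb := flattenSeq_mem hσ
    rw [Nat.succ_mul, abs_deriv_comp_add hb]
    have hmap := mapsTo_comp (Φ := Φ) (ω := fun r => flattenSeq S.p σ (q * S.p + r))
      (fun k => hb _) S.p hx
    refine (mul_le_mul (ih hmap) ?_ (abs_nonneg _) (Real.exp_pos _).le).trans
      (b := Real.exp (-(S.γ * (q * S.p : ℕ))) * Real.exp (-(S.γ * S.p))) ?_
    · rw [comp_flattenSeq_word hσ]
      exact (S.hWcontr _ (hσ q) x hx).le
    · rw [← Real.exp_add]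
      apply le_of_eq
      congr 1
      push_cast
      ring

/-- The maps of the inserted digits contract at most polynomially. -/
def InsertedLowerBound (S : InsSetup Φ Pi) (Q : ℝ) : Prop :=
  ∀ k, ∀ x ∈ Icc (0:ℝ) 1,
    1 ≤ Q * (S.nseq (k + 1) : ℝ) ^ S.d * |deriv (Φ.φ ⌊S.α * tau (S.nseq (k + 1))⌋₊) x|

lemma comp_digits_block (σ : ℕ → List ℕ) {k i : ℕ} (hi : i ≤ S.mseq k) :
    comp Φ.φ (fun r => S.digits σ (S.nseq k + r)) (i * S.p) =
      comp Φ.φ (fun r => flattenSeq S.p σ (S.wordCount k * S.p + r)) (i * S.p) :=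
  comp_congr fun _ hr => digits_block σ (hr.trans_le (Nat.mul_le_mul_right _ hi))

lemma abs_deriv_comp_flattenSeq_le_block (hσ : ∀ k, σ k ∈ S.W) {k i : ℕ} (hi : i ≤ S.mseq k)
    {E : ℝ} (hE : 0 ≤ E)
    (hk : ∀ x ∈ Icc (0:ℝ) 1, ∀ y ∈ Icc (0:ℝ) 1,
      |deriv (comp Φ.φ (flattenSeq S.p σ) (S.wordCount k * S.p)) y| ≤
        E * |deriv (comp Φ.φ (S.digits σ) (S.nseq k)) x|)
    {x y : ℝ} (hx : x ∈ Icc (0:ℝ) 1) (hy : y ∈ Icc (0:ℝ) 1) :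
    |deriv (comp Φ.φ (flattenSeq S.p σ) ((S.wordCount k + i) * S.p)) y| ≤
      E * Φ.distC * |deriv (comp Φ.φ (S.digits σ) (S.nseq k + i * S.p)) x| := by
  have hb := flattenSeq_mem hσ
  have ha := digits_mem hσ
  have hs : (fun r => flattenSeq S.p σ (S.wordCount k * S.p + r)) ∈ Φ.Seqs := fun _ => hb _
  rw [add_mul, abs_deriv_comp_add hb, abs_deriv_comp_add ha, comp_digits_block σ hi]
  calc _ ≤ (E * _) * (Φ.distC * _) :=
        mul_le_mul (hk _ (mapsTo_comp hs _ hx) _ (mapsTo_comp hs _ hy))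
          (distortion_words hσ _ _ hy hx) (abs_nonneg _) (mul_nonneg hE (abs_nonneg _))
    _ = _ := by ring

lemma abs_deriv_comp_flattenSeq_le_digits {c : ℝ} (hc : 0 ≤ c) (hQ : S.InsertedLowerBound c)
    (hσ : ∀ k, σ k ∈ S.W) (k : ℕ) :
    ∀ x ∈ Icc (0:ℝ) 1, ∀ y ∈ Icc (0:ℝ) 1,
      |deriv (comp Φ.φ (flattenSeq S.p σ) (S.wordCount k * S.p)) y| ≤
        (Φ.distC * c * (S.nseq k : ℝ) ^ S.d) ^ k *
          |deriv (comp Φ.φ (S.digits σ) (S.nseq k)) x| := by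
  have hD := Φ.distC_ge_one
  have hd := S.hd
  induction k with
  | zero => simp [wordCount, S.hn0, comp]
  | succ k ih =>
    intro x hx y hy
    have ha := digits_mem hσ
    set z := Φ.φ ⌊S.α * tau (S.nseq (k + 1))⌋₊ x with hz
    have hzm : z ∈ Icc (0:ℝ) 1 := Φ.maps_to _ (S.hins (k + 1) (by omega)) hx
    have h1 := abs_deriv_comp_flattenSeq_le_block hσ (le_refl (S.mseq k)) (by positivity) ih
      hzm hy
    have h2 := hQ k x hx
    have hmono : (S.nseq k : ℝ) ^ S.d ≤ (S.nseq (k + 1) : ℝ) ^ S.d := by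
      have := S.nseq_strictMono.monotone (Nat.le_succ k)
      gcongr
    have hsplit : |deriv (comp Φ.φ (S.digits σ) (S.nseq (k + 1))) x| =
        |deriv (comp Φ.φ (S.digits σ) (S.nseq k + S.mseq k * S.p)) z| *
          |deriv (Φ.φ ⌊S.α * tau (S.nseq (k + 1))⌋₊) x| := by
      conv_lhs => rw [S.hnrec k]
      rw [abs_deriv_comp_succ ha, digits_insert]
    rw [hsplit, wordCount_succ]
    set F := |deriv (comp Φ.φ (S.digits σ) (S.nseq k + S.mseq k * S.p)) z|
    set f := |deriv (Φ.φ ⌊S.α * tau (S.nseq (k + 1))⌋₊) x|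
    have hF : 0 ≤ F := abs_nonneg _
    calc _ ≤ (Φ.distC * c * (S.nseq k : ℝ) ^ S.d) ^ k * Φ.distC * F * 1 := by simpa using h1
      _ ≤ (Φ.distC * c * (S.nseq (k + 1) : ℝ) ^ S.d) ^ k * Φ.distC * F *
          (c * (S.nseq (k + 1) : ℝ) ^ S.d * f) := by
        gcongr
      _ = _ := by ring

lemma le_nseq_rpow (k : ℕ) : (k : ℝ) ≤ (S.nseq k : ℝ) ^ (1 / S.d) := by
  have hd := S.hd
  have hd0 : 0 < S.d := by linarith
  rcases k with _ | k
  · simpa using Real.rpow_nonneg (Nat.cast_nonneg _) _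
  · rw [one_div, Real.le_rpow_inv_iff_of_pos (by positivity) (by positivity) hd0]
    have h1 := S.hmhigh k
    have h2 : ((k + 1 : ℕ) : ℝ) ^ S.d ≤ ((k : ℝ) + S.p + 1) ^ S.d := by
      apply Real.rpow_le_rpow (by positivity) _ hd0.le
      push_cast
      have : (0:ℝ) ≤ S.p := by positivity
      linarith
    rw [S.hnrec k] at *
    push_cast at *
    linarith

lemma exists_growth_bound (Q : ℝ) (hQ : 1 ≤ Q) : ∃ C : ℝ, 0 ≤ C ∧ ∀ k q, S.wordCount k ≤ q →
    (Q * (S.nseq k : ℝ) ^ S.d) ^ k * Real.exp (-(S.γ * S.ε * (q * S.p : ℕ))) ≤ C := by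
  have hd := S.hd
  have hB : 0 < S.γ * S.ε := mul_pos S.hγ S.hε
  obtain ⟨C, hC⟩ := exists_rpow_mul_log_le (A := Real.log Q + S.γ * S.ε) hd hB
  refine ⟨Real.exp (max C 0), (Real.exp_pos _).le, fun k q hq => ?_⟩
  rcases Nat.eq_zero_or_pos k with rfl | hk
  · rw [pow_zero, one_mul]
    apply Real.exp_le_exp.2
    have : 0 ≤ S.γ * S.ε * (q * S.p : ℕ) := by positivity
    have := le_max_right C 0
    linarith
  have hkn : k ≤ S.nseq k := S.nseq_strictMono.le_apply
  have hn1 : 1 ≤ S.nseq k := by omega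
  have hn : (0:ℝ) < S.nseq k := by exact_mod_cast hn1
  have hpos : 0 < Q * (S.nseq k : ℝ) ^ S.d := by positivity
  have hexp : (Q * (S.nseq k : ℝ) ^ S.d) ^ k =
      Real.exp (k * (Real.log Q + S.d * Real.log (S.nseq k))) := by
    rw [← Real.log_rpow hn, ← Real.log_mul (by positivity) (by positivity), Real.exp_nat_mul,
      Real.exp_log hpos]
  rw [hexp, ← Real.exp_add]
  apply Real.exp_le_exp.2
  have hlog : 0 ≤ Real.log Q + S.γ * S.ε + S.d * Real.log (S.nseq k) := by
    have := Real.log_nonneg hQ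
    have := Real.log_nonneg (show (1:ℝ) ≤ S.nseq k by exact_mod_cast hn1)
    positivity
  have h1 := mul_le_mul_of_nonneg_right (S.le_nseq_rpow k) hlog
  have h2 := hC _ hn1
  have h3 : (S.nseq k : ℝ) ≤ (q * S.p : ℕ) + k := by
    have := Nat.mul_le_mul_right S.p hq
    have := S.nseq_eq k
    exact_mod_cast (by omega)
  have h4 := mul_le_mul_of_nonneg_left h3 hB.le
  have := le_max_left C 0
  linarith

lemma exists_separation (S : InsSetup Φ Pi) : ∃ K : ℝ, 0 < K ∧ ∀ w ∈ S.W, ∀ w' ∈ S.W, w ≠ w' →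
    ∀ u ∈ Jset Φ w, ∀ v ∈ Jset Φ w', K ≤ |u - v| := by
  have hcomp : ∀ w ∈ S.W, IsCompact (Jset Φ w) := fun w hw =>
    isCompact_Icc.image (continuous_wcomp (S.hWsub hw).2)
  set T : Set (ℝ × ℝ) := ⋃ z ∈ S.W.offDiag, Jset Φ z.1 ×ˢ Jset Φ z.2 with hT
  have hTc : IsCompact T := by
    refine S.W.offDiag.finite_toSet.isCompact_biUnion fun z hz => ?_
    have hz' := Finset.mem_offDiag.1 (Finset.mem_coe.1 hz)
    exact (hcomp _ hz'.1).prod (hcomp _ hz'.2.1)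
  have hmem : ∀ w ∈ S.W, ∀ w' ∈ S.W, w ≠ w' → ∀ u ∈ Jset Φ w, ∀ v ∈ Jset Φ w', (u, v) ∈ T := by
    intro w hw w' hw' hne u hu v hv
    simp only [hT, mem_iUnion]
    exact ⟨(w, w'), Finset.mem_offDiag.2 ⟨hw, hw', hne⟩, hu, hv⟩
  rcases T.eq_empty_or_nonempty with h0 | hne
  · refine ⟨1, one_pos, fun w hw w' hw' hne u hu v hv => ?_⟩
    have := hmem w hw w' hw' hne u hu v hv
    rw [h0] at this
    exact this.elim
  · obtain ⟨z, hz, hmin⟩ := hTc.exists_isMinOn hne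
      (f := fun z : ℝ × ℝ => |z.1 - z.2|) (by fun_prop)
    refine ⟨|z.1 - z.2|, ?_, fun w hw w' hw' hne u hu v hv =>
      hmin (hmem w hw w' hw' hne u hu v hv)⟩
    rw [abs_pos, sub_ne_zero]
    intro he
    simp only [hT, mem_iUnion] at hz
    obtain ⟨⟨w, w'⟩, hww, hu, hv⟩ := hz
    obtain ⟨hw, hw', hne⟩ := Finset.mem_offDiag.1 hww
    have : z.1 ∈ Jset Φ w ∩ Jset Φ w' := ⟨hu, by rw [he]; exact hv⟩
    rw [S.hWdisj w hw w' hw' hne] at this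
    exact this

/-- If some inserted digit is the index `0` and `φ 0` is constant on `[0,1]`, the construction
produces only finitely many points. -/
lemma finite_LpSet_of_deriv_eq_zero {k : ℕ} (h0 : ⌊S.α * tau (S.nseq (k + 1))⌋₊ = 0)
    (hder : ∀ x ∈ Icc (0:ℝ) 1, deriv (Φ.φ 0) x = 0) :
    (LpSet Φ Pi (↑S.W : Set (List ℕ)) S.p S.nseq S.α).Finite := by
  have hI : 0 ∈ Φ.I := h0 ▸ S.hins (k + 1) (by omega)
  have hconst : ∀ x ∈ Icc (0:ℝ) 1, Φ.φ 0 x = Φ.φ 0 0 := by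
    intro x hx
    obtain ⟨ξ, hξ, h⟩ := exists_abs_sub_eq_abs_deriv_mul
      ((Φ.smooth 0 hI).differentiable (by norm_num)) hx (left_mem_Icc.2 zero_le_one)
    rw [hder ξ hξ, abs_zero, zero_mul, abs_eq_zero, sub_eq_zero] at h
    exact h
  set q := S.wordCount k + S.mseq k with hq
  let ext (s : Fin q → S.W) (j : ℕ) : List ℕ := if h : j < q then (s ⟨j, h⟩ : List ℕ) else []
  refine (Set.finite_range fun s : Fin q → S.W =>
    comp Φ.φ (S.digits (ext s)) (S.nseq k + S.mseq k * S.p) (Φ.φ 0 0)).subset ?_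
  rintro x ⟨σ, hσ, rfl⟩
  refine ⟨fun j => ⟨σ j, hσ j⟩, ?_⟩
  obtain ⟨t, ht, he⟩ := S.hPi _ (digits_mem hσ) (S.nseq k + S.mseq k * S.p + 1)
  change comp Φ.φ (S.digits σ) (S.nseq k + S.mseq k * S.p) (Φ.φ _ t) = _ at he
  rw [digits_insert, h0, hconst t ht] at he
  refine Eq.trans ?_ he
  refine congrFun (comp_congr fun r hr => ?_) _
  refine digits_congr (k := k) (i := S.mseq k) (fun j hj => ?_) le_rfl hr
  simp only [ext]
  rw [dif_pos (by omega)]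

lemma exists_insertedDigit_le (S : InsSetup Φ Pi) : ∃ A : ℝ, 0 < A ∧ ∀ k,
    (⌊S.α * tau (S.nseq (k + 1))⌋₊ : ℝ) ≤ A * S.nseq (k + 1) ∧ (1:ℝ) ≤ S.nseq (k + 1) := by
  have h5 : 1 < Real.log 5 := by
    rw [Real.lt_log_iff_exp_lt (by norm_num)]
    linarith [Real.exp_one_lt_d9]
  have hl : 0 < Real.log (Real.log 5) := Real.log_pos h5
  have hα := S.hα
  refine ⟨S.α / Real.log (Real.log 5), by positivity, fun k => ?_⟩
  have hn : 5 ≤ S.nseq (k + 1) := by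
    have h1 := S.hnrec k
    have h2 := Nat.mul_le_mul (S.hm2 k) S.hp2
    omega
  have hnR : (5:ℝ) ≤ S.nseq (k + 1) := by exact_mod_cast hn
  refine ⟨?_, by linarith⟩
  have hle : Real.log (Real.log 5) ≤ Real.log (Real.log (S.nseq (k + 1))) := by
    gcongr
  have hτ : 0 ≤ tau (S.nseq (k + 1)) := div_nonneg (by positivity) (hl.le.trans hle)
  refine (Nat.floor_le (by positivity)).trans ?_
  unfold tau
  rw [div_mul_eq_mul_div, ← mul_div_assoc]
  gcongr

lemma exists_insertedLowerBound
    (hS : ∀ k, ⌊S.α * tau (S.nseq (k + 1))⌋₊ = 0 → ∃ x ∈ Icc (0:ℝ) 1, deriv (Φ.φ 0) x ≠ 0) :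
    ∃ Q, 1 ≤ Q ∧ S.InsertedLowerBound Q := by
  obtain ⟨c, hc, hdec⟩ := S.hdec
  obtain ⟨⟨D, hD⟩, -⟩ := S.hB2
  obtain ⟨A, hA, hdig⟩ := S.exists_insertedDigit_le
  have hd0 : 0 < S.d := by linarith [S.hd]
  obtain ⟨b, hb, hzero⟩ : ∃ b : ℝ, 0 < b ∧ ∀ k, ⌊S.α * tau (S.nseq (k + 1))⌋₊ = 0 →
      ∀ x ∈ Icc (0:ℝ) 1, b ≤ |deriv (Φ.φ 0) x| := by
    by_cases h : ∃ k, ⌊S.α * tau (S.nseq (k + 1))⌋₊ = 0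
    · obtain ⟨k, hk⟩ := h
      obtain ⟨x₀, hx₀, hne⟩ := hS k hk
      have hI : 0 ∈ Φ.I := hk ▸ S.hins (k + 1) (by omega)
      have hpos := abs_pos.2 hne
      have hDpos : 0 < D := by
        by_contra! hneg
        have := hD 0 hI x₀ hx₀ x₀ hx₀
        nlinarith
      refine ⟨|deriv (Φ.φ 0) x₀| / D, by positivity, fun _ _ x hx => ?_⟩
      rw [div_le_iff₀ hDpos, mul_comm]
      exact hD 0 hI x₀ hx₀ x hx
    · exact ⟨1, one_pos, fun k hk => (h ⟨k, hk⟩).elim⟩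
  refine ⟨max 1 (max (1 / b) (A ^ S.d / c)), le_max_left _ _, fun k x hx => ?_⟩
  obtain ⟨hle, hn1⟩ := hdig k
  have hI := S.hins (k + 1) (by omega)
  have hnd : 1 ≤ (S.nseq (k + 1) : ℝ) ^ S.d := Real.one_le_rpow hn1 hd0.le
  set i := ⌊S.α * tau (S.nseq (k + 1))⌋₊ with hi
  rcases Nat.eq_zero_or_pos i with h0 | hpos
  · have h1 := hzero k h0 x hx
    rw [h0]
    calc (1:ℝ) = 1 / b * 1 * b := by field_simp
      _ ≤ _ := by
        gcongr
        exact (le_max_left _ _).trans (le_max_right _ _)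
  · have h1 := hdec i hI x hx
    have hiR : (0:ℝ) < i := by exact_mod_cast hpos
    have h2 : (i : ℝ) ^ S.d ≤ A ^ S.d * (S.nseq (k + 1) : ℝ) ^ S.d := by
      rw [← Real.mul_rpow hA.le (by positivity)]
      gcongr
    have hipos : 0 < (i : ℝ) ^ S.d := by positivity
    calc (1:ℝ) = (i : ℝ) ^ S.d / c * (c / (i : ℝ) ^ S.d) := by field_simp
      _ ≤ (A ^ S.d * (S.nseq (k + 1) : ℝ) ^ S.d) / c * |deriv (Φ.φ i) x| := by gcongr
      _ = A ^ S.d / c * (S.nseq (k + 1) : ℝ) ^ S.d * |deriv (Φ.φ i) x| := by ring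
      _ ≤ _ := by
        gcongr
        exact (le_max_right _ _).trans (le_max_right _ _)

lemma exists_abs_sub_rpow_le {Q : ℝ} (hQ : 1 ≤ Q) (hlow : S.InsertedLowerBound Q) :
    ∃ C : ℝ, 0 ≤ C ∧ ∀ σ σ' : ℕ → List ℕ, (∀ k, σ k ∈ S.W) → (∀ k, σ' k ∈ S.W) →
      |Pi (flattenSeq S.p σ) - Pi (flattenSeq S.p σ')| ^ (1 + S.ε) ≤
        C * |Pi (S.digits σ) - Pi (S.digits σ')| := by
  have hε := S.hε
  have hD := Φ.distC_ge_one
  obtain ⟨K, hK, hsep⟩ := S.exists_separation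
  obtain ⟨C, hC0, hC⟩ := S.exists_growth_bound (Φ.distC * Q) (one_le_mul_of_one_le_of_one_le hD hQ)
  refine ⟨C * Φ.distC / K, by positivity, fun σ σ' hσ hσ' => ?_⟩
  rcases eq_or_ne σ σ' with rfl | hne
  · simp only [sub_self, abs_zero, mul_zero]
    rw [Real.zero_rpow (by linarith)]
  have hex : ∃ q, σ q ≠ σ' q := Function.ne_iff.1 hne
  obtain ⟨q, hq, hlt⟩ : ∃ q, σ q ≠ σ' q ∧ ∀ j < q, σ j = σ' j :=
    ⟨Nat.find hex, Nat.find_spec hex, fun j hj => not_not.1 (Nat.find_min hex hj)⟩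
  obtain ⟨k, i, rfl, hi⟩ := S.exists_wordCount_add q
  have ha := digits_mem hσ
  have hb := flattenSeq_mem hσ
  have tail : ∀ ρ : ℕ → List ℕ, (∀ k, ρ k ∈ S.W) →
      (∀ j < S.wordCount k + i, σ j = ρ j) → ∃ u ∈ Jset Φ (ρ (S.wordCount k + i)),
      Pi (S.digits ρ) = comp Φ.φ (S.digits σ) (S.nseq k + i * S.p) u := by
    intro ρ hρ hag
    obtain ⟨t, ht, he⟩ := S.hPi _ (digits_mem hρ) (S.nseq k + i * S.p + S.p)
    refine ⟨_, mem_image_of_mem _ ht, ?_⟩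
    rw [← he, comp_add, ← comp_flattenSeq_word hρ,
      comp_congr fun r hr => digits_congr hag hi.le hr]
    refine congrArg _ (congrFun (comp_congr fun r hr => ?_) _)
    have h1 := Nat.mul_le_mul_right S.p (show i + 1 ≤ S.mseq k from hi)
    rw [add_mul, one_mul] at h1
    rw [add_assoc, digits_block ρ (by omega), add_mul, add_assoc]
  have tail' : ∀ ρ : ℕ → List ℕ, (∀ k, ρ k ∈ S.W) →
      (∀ j < S.wordCount k + i, σ j = ρ j) → ∃ v ∈ Icc (0:ℝ) 1,
      Pi (flattenSeq S.p ρ) = comp Φ.φ (flattenSeq S.p σ) ((S.wordCount k + i) * S.p) v := by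
    intro ρ hρ hag
    obtain ⟨t, ht, he⟩ := S.hPi _ (flattenSeq_mem hρ) ((S.wordCount k + i) * S.p)
    exact ⟨t, ht, by rw [← he, comp_congr fun r hr => flattenSeq_congr hag hr]⟩
  have hJ : ∀ w ∈ S.W, Jset Φ w ⊆ Icc (0:ℝ) 1 := by
    intro w hw
    have := comp_flattenSeq_word (S := S) (σ := fun _ => w) (fun _ => hw) 0
    unfold Jset
    rw [← this]
    exact (mapsTo_comp (fun r => flattenSeq_mem (fun _ => hw) _) _).image_subset
  obtain ⟨u, hu, hxu⟩ := tail σ hσ fun _ _ => rfl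
  obtain ⟨u', hu', hxu'⟩ := tail σ' hσ' hlt
  obtain ⟨v, hv, hyv⟩ := tail' σ hσ fun _ _ => rfl
  obtain ⟨v', hv', hyv'⟩ := tail' σ' hσ' hlt
  obtain ⟨ξ, hξ, hx⟩ := exists_abs_sub_eq_abs_deriv_mul
    (differentiable_comp ha (S.nseq k + i * S.p)) (hJ _ (hσ _) hu) (hJ _ (hσ' _) hu')
  obtain ⟨η, hη, hy⟩ := exists_abs_sub_eq_abs_deriv_mul
    (differentiable_comp hb ((S.wordCount k + i) * S.p)) hv hv'
  have hK' := hsep _ (hσ _) _ (hσ' _) hq u hu u' hu'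
  have hE : 0 ≤ (Φ.distC * Q * (S.nseq k : ℝ) ^ S.d) ^ k := by positivity
  have hGF := abs_deriv_comp_flattenSeq_le_block hσ hi.le hE
    (abs_deriv_comp_flattenSeq_le_digits (by linarith) hlow hσ k) hξ hη
  have hG := abs_deriv_comp_flattenSeq_le hσ (S.wordCount k + i) hη
  have hgrow := hC k (S.wordCount k + i) (by omega)
  rw [hyv, hyv', hxu, hxu', hx, hy]
  set G := |deriv (comp Φ.φ (flattenSeq S.p σ) ((S.wordCount k + i) * S.p)) η|
  set F := |deriv (comp Φ.φ (S.digits σ) (S.nseq k + i * S.p)) ξ|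
  set E := (Φ.distC * Q * (S.nseq k : ℝ) ^ S.d) ^ k
  have hG0 : 0 ≤ G := abs_nonneg _
  have hF0 : 0 ≤ F := abs_nonneg _
  have hvv : |v - v'| ≤ 1 := by
    rw [abs_le]
    constructor <;> linarith [hv.1, hv.2, hv'.1, hv'.2]
  calc (G * |v - v'|) ^ (1 + S.ε) ≤ G ^ (1 + S.ε) := by
        apply Real.rpow_le_rpow (by positivity) _ (by linarith)
        exact mul_le_of_le_one_right hG0 hvv
    _ = G * G ^ S.ε := by
        rw [Real.rpow_add' hG0 (by linarith), Real.rpow_one]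
    _ ≤ (E * Φ.distC * F) *
          Real.exp (-(S.γ * ((S.wordCount k + i) * S.p : ℕ))) ^ S.ε := by
        gcongr
    _ = (E * Real.exp (-(S.γ * S.ε * ((S.wordCount k + i) * S.p : ℕ)))) * (Φ.distC * F) := by
        rw [← Real.exp_mul]
        ring_nf
    _ ≤ C * (Φ.distC * F) := by gcongr
    _ = C * Φ.distC / K * (F * K) := by field_simp
    _ ≤ _ := by gcongr

end InsSetup

/-- **Proposition.** The map `h_ε : L_p(α) → Λ(Φ_p)`, inverse of `y ↦ x(y)` (eliminating
all the inserted digits), is Hölder continuous with exponent `1/(1+ε)`. -/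
theorem holder_of_elimination (Φ : PIFS) (Pi : (ℕ → ℕ) → ℝ) (S : InsSetup Φ Pi) (h : ℝ → ℝ)
    (hinv : ∀ σ : ℕ → List ℕ, (∀ k, σ k ∈ S.W) → ∀ y : ℝ,
      (∀ n, y ∈ seqComp Φ.φ σ n '' Icc (0:ℝ) 1) →
      h (Pi (insertSeq S.nseq S.α (flattenSeq S.p σ))) = y) :
    ∃ C : ℝ, 0 ≤ C ∧ ∀ x ∈ LpSet Φ Pi (↑S.W : Set (List ℕ)) S.p S.nseq S.α,
      ∀ y ∈ LpSet Φ Pi (↑S.W : Set (List ℕ)) S.p S.nseq S.α,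
        |h x - h y| ≤ C * |x - y| ^ (1 / (1 + S.ε)) := by
  have hval : ∀ σ : ℕ → List ℕ, (∀ k, σ k ∈ S.W) →
      h (Pi (S.digits σ)) = Pi (flattenSeq S.p σ) := fun σ hσ =>
    hinv σ hσ _ fun n => by
      rw [InsSetup.seqComp_eq_comp hσ]
      exact S.hPi _ (InsSetup.flattenSeq_mem hσ) _
  by_cases hdeg : ∃ k, ⌊S.α * tau (S.nseq (k + 1))⌋₊ = 0 ∧
      ∀ x ∈ Icc (0:ℝ) 1, deriv (Φ.φ 0) x = 0
  · obtain ⟨k, hk, hder⟩ := hdeg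
    exact exists_holder_of_finite (InsSetup.finite_LpSet_of_deriv_eq_zero hk hder) h _
  push Not at hdeg
  obtain ⟨Q, hQ, hlow⟩ := InsSetup.exists_insertedLowerBound hdeg
  obtain ⟨C, hC0, hC⟩ := InsSetup.exists_abs_sub_rpow_le hQ hlow
  have hε := S.hε
  refine ⟨C ^ (1 / (1 + S.ε)), by positivity, ?_⟩
  rintro x ⟨σ, hσ, rfl⟩ y ⟨σ', hσ', rfl⟩
  change |h (Pi (S.digits σ)) - h (Pi (S.digits σ'))| ≤
    _ * |Pi (S.digits σ) - Pi (S.digits σ')| ^ _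
  rw [hval σ hσ, hval σ' hσ', ← Real.mul_rpow hC0 (abs_nonneg _), one_div,
    Real.le_rpow_inv_iff_of_pos (abs_nonneg _) (by positivity) (by linarith)]
  exact hC σ σ' hσ hσ'

end

end ParabolicIFSPaper
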